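/- arXiv:2210.05537 — 2 statements merged into one kernel-verified Lean document; each statement's English description precedes it below -/
import Mathlib

section
/- The set of limiting probabilities { lim_{n→∞} |{σ ∈ Av_n(231) : σ ⊨ Ψ}| / Cat_n : Ψ a first-order sentence in the language with two binary relation symbols <_P and <_V } is dense in the interval [0,1]. -/
open FirstOrder Filter Asymptotics Topology

namespace Av231

/-- Relation symbols of the theory of two orders: two binary relations `<_P` and `<_V`. -/
inductive TwoRel : ℕ → Type
  | lp : TwoRel 2
  | lv : TwoRel 2

/-- The first-order language with two binary relation symbols `<_P` and `<_V`. -/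
def L : Language := ⟨fun _ => Empty, TwoRel⟩

/-- The `L`-structure on `Fin n` associated with a permutation `σ` of `{1,…,n}`:
`i <_P j` iff `i < j` and `i <_V j` iff `σ i < σ j`. -/
def pStruct {n : ℕ} (σ : Equiv.Perm (Fin n)) : L.Structure (Fin n) where
  funMap := fun f _ => nomatch f
  RelMap := fun r x =>
    match r with
    | .lp => x 0 < x 1
    | .lv => σ (x 0) < σ (x 1)

/-- A permutation satisfies a first-order sentence. -/
def Sat {n : ℕ} (σ : Equiv.Perm (Fin n)) (ψ : L.Sentence) : Prop :=
  @Language.Sentence.Realize L (Fin n) (pStruct σ) ψ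

/-- The quantifier depth of a first-order formula. -/
def qd {L' : Language} {α : Type*} : ∀ {n : ℕ}, L'.BoundedFormula α n → ℕ
  | _, .falsum => 0
  | _, .equal _ _ => 0
  | _, .rel _ _ => 0
  | _, .imp f g => max (qd f) (qd g)
  | _, .all f => qd f + 1

/-- A permutation avoids the pattern `231`. -/
def Avoids {n : ℕ} (σ : Equiv.Perm (Fin n)) : Prop :=
  ¬ ∃ i j k : Fin n, i < j ∧ j < k ∧ σ k < σ i ∧ σ i < σ j

/-- The number of `231`-avoiding permutations of size `n` satisfying `ψ`. -/
noncomputable def avN (n : ℕ) (ψ : L.Sentence) : ℕ :=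
  Nat.card {σ : Equiv.Perm (Fin n) // Avoids σ ∧ Sat σ ψ}

/-- The probability that a uniform random `231`-avoiding permutation of size `n`
satisfies `ψ` (the number of `231`-avoiding permutations of size `n` is `catalan n`). -/
noncomputable def prob (n : ℕ) (ψ : L.Sentence) : ℝ :=
  (avN n ψ : ℝ) / (catalan n : ℝ)

/-- Permutations of arbitrary finite size. -/
abbrev FinPerm := Σ n : ℕ, Equiv.Perm (Fin n)

def AvoidsF (p : FinPerm) : Prop := Avoids p.2

/-- Direct sum of permutations. -/
def dsum {a b : ℕ} (σ : Equiv.Perm (Fin a)) (τ : Equiv.Perm (Fin b)) :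
    Equiv.Perm (Fin (a + b)) :=
  finSumFinEquiv.permCongr (Equiv.sumCongr σ τ)

/-- Skew sum of permutations. -/
def ssum {a b : ℕ} (σ : Equiv.Perm (Fin a)) (τ : Equiv.Perm (Fin b)) :
    Equiv.Perm (Fin (a + b)) :=
  finSumFinEquiv.symm.trans ((Equiv.sumCongr σ τ).trans
    ((Equiv.sumComm (Fin a) (Fin b)).trans (finSumFinEquiv.trans (finCongr (Nat.add_comm b a)))))

/-- The operation `(τ, π) ↦ τ ⊕ (1 ⊖ π)` on permutations of arbitrary sizes. -/
def glue (τ π : FinPerm) : FinPerm :=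
  ⟨τ.1 + (1 + π.1), dsum τ.2 (ssum (1 : Equiv.Perm (Fin 1)) π.2)⟩

/-- Two permutations are `k`-equivalent when they satisfy the same first-order sentences
of quantifier depth at most `k`. -/
def kEquiv (k : ℕ) (p q : FinPerm) : Prop :=
  ∀ ψ : L.Sentence, qd ψ ≤ k → (Sat p.2 ψ ↔ Sat q.2 ψ)


/-! ### Counting `231`-avoiding permutations -/

/-- The number of `231`-avoiding permutations of size `n`. -/
noncomputable def avCard (n : ℕ) : ℕ := Nat.card {σ : Equiv.Perm (Fin n) // Avoids σ}

/-- The one-line word of `τ ⊕ (1 ⊖ π)`, where `τ` has size `k` and the total size is `n + 1`. -/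
def joinFun {n : ℕ} (k : Fin (n + 1)) (τ : Equiv.Perm (Fin k)) (π : Equiv.Perm (Fin (n - k)))
    (i : Fin (n + 1)) : Fin (n + 1) :=
  if h : i.1 < k.1 then ⟨τ ⟨i, h⟩, by have := (τ ⟨i, h⟩).2; omega⟩
  else if h' : k.1 < i.1 then
    ⟨k + π ⟨i - (k + 1), by omega⟩, by have := (π ⟨i - (k + 1), by omega⟩).2; omega⟩
  else Fin.last n

section Join

variable {n : ℕ} {k : Fin (n + 1)} {τ : Equiv.Perm (Fin k)} {π : Equiv.Perm (Fin (n - k))}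

lemma joinFun_of_lt {i : Fin (n + 1)} (h : i.1 < k.1) :
    (joinFun k τ π i : ℕ) = τ ⟨i, h⟩ := by
  simp [joinFun, h]

lemma joinFun_of_gt {i : Fin (n + 1)} (h : k.1 < i.1) :
    (joinFun k τ π i : ℕ) = k + π ⟨i - (k + 1), by omega⟩ := by
  simp [joinFun, h, h.not_gt]

lemma joinFun_self : joinFun k τ π k = Fin.last n := by
  simp [joinFun]

lemma joinFun_lt_of_lt {i : Fin (n + 1)} (h : i.1 < k.1) : (joinFun k τ π i : ℕ) < k := by
  rw [joinFun_of_lt h]; exact (τ _).2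

lemma joinFun_mem_of_gt {i : Fin (n + 1)} (h : k.1 < i.1) :
    k.1 ≤ joinFun k τ π i ∧ (joinFun k τ π i : ℕ) < n := by
  rw [joinFun_of_gt h]
  have := (π ⟨i - (k + 1), by omega⟩).2
  omega

lemma joinFun_injective : Function.Injective (joinFun k τ π) := by
  intro i j hij
  have hv : (joinFun k τ π i : ℕ) = joinFun k τ π j := by rw [hij]
  have hk : (joinFun k τ π k : ℕ) = n := by rw [joinFun_self]; rfl
  have hkn := k.2
  rcases lt_trichotomy i k with hi | hi | hi <;> rcases lt_trichotomy j k with hj | hj | hj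
  · rw [joinFun_of_lt hi, joinFun_of_lt hj] at hv
    have := τ.injective (Fin.ext hv)
    simp only [Fin.mk.injEq] at this
    exact Fin.ext this
  · subst hj
    have := joinFun_lt_of_lt (τ := τ) (π := π) hi
    omega
  · have := joinFun_lt_of_lt (τ := τ) (π := π) hi
    have := joinFun_mem_of_gt (τ := τ) (π := π) hj
    omega
  · subst hi
    have := joinFun_lt_of_lt (τ := τ) (π := π) hj
    omega
  · exact hi.trans hj.symm
  · subst hi
    have := joinFun_mem_of_gt (τ := τ) (π := π) hj
    omega
  · have := joinFun_lt_of_lt (τ := τ) (π := π) hj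
    have := joinFun_mem_of_gt (τ := τ) (π := π) hi
    omega
  · subst hj
    have := joinFun_mem_of_gt (τ := τ) (π := π) hi
    omega
  · rw [joinFun_of_gt hi, joinFun_of_gt hj] at hv
    have := π.injective (Fin.ext (Nat.add_left_cancel hv))
    simp only [Fin.mk.injEq] at this
    apply Fin.ext
    have h1 : k.1 < i.1 := hi
    have h2 : k.1 < j.1 := hj
    omega

variable (k τ π) in
/-- The permutation `τ ⊕ (1 ⊖ π)` with its maximum at position `k`. -/
noncomputable def join : Equiv.Perm (Fin (n + 1)) :=
  Equiv.ofBijective (joinFun k τ π) (Finite.injective_iff_bijective.1 joinFun_injective)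

lemma join_apply (i : Fin (n + 1)) : join k τ π i = joinFun k τ π i := rfl

lemma join_avoids (hτ : Avoids τ) (hπ : Avoids π) : Avoids (join k τ π) := by
  rintro ⟨a, b, c, hab, hbc, hca, hab'⟩
  simp only [join_apply, Fin.lt_def] at *
  have hk : (joinFun k τ π k : ℕ) = n := by rw [joinFun_self]; rfl
  rcases lt_trichotomy c k with hc | hc | hc
  · have ha : a.1 < k.1 := by omega
    have hb : b.1 < k.1 := by omega
    rw [joinFun_of_lt ha, joinFun_of_lt hc] at hca
    rw [joinFun_of_lt ha, joinFun_of_lt hb] at hab'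
    exact hτ ⟨⟨a, ha⟩, ⟨b, hb⟩, ⟨c, hc⟩, hab, hbc, hca, hab'⟩
  · subst hc
    omega
  · have hc' := joinFun_mem_of_gt (τ := τ) (π := π) hc
    rcases lt_trichotomy a k with ha | ha | ha
    · have := joinFun_lt_of_lt (τ := τ) (π := π) ha
      omega
    · subst ha
      omega
    · have ha' : k.1 < a.1 := ha
      have hb : k.1 < b.1 := by omega
      rw [joinFun_of_gt ha, joinFun_of_gt hc] at hca
      rw [joinFun_of_gt ha, joinFun_of_gt hb] at hab'
      refine hπ ⟨⟨a - (k + 1), by omega⟩, ⟨b - (k + 1), by omega⟩, ⟨c - (k + 1), by omega⟩,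
        ?_, ?_, ?_, ?_⟩ <;> simp only [Fin.lt_def] <;> omega

end Join

lemma join_injective {n : ℕ} (k : Fin (n + 1)) {τ τ' : Equiv.Perm (Fin k)}
    {π π' : Equiv.Perm (Fin (n - k))} (h : join k τ π = join k τ' π') : τ = τ' ∧ π = π' := by
  have key (i : Fin (n + 1)) : (joinFun k τ π i : ℕ) = joinFun k τ' π' i := by
    rw [← join_apply, ← join_apply, h]
  constructor
  · ext i
    have := key ⟨i, by omega⟩
    rwa [joinFun_of_lt (show _ < _ from i.2), joinFun_of_lt (show _ < _ from i.2)] at this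
  · ext i
    have hi : k.1 < (⟨k + 1 + i, by omega⟩ : Fin (n + 1)).1 := by
      simp only; omega
    have := key ⟨k + 1 + i, by omega⟩
    rw [joinFun_of_gt hi, joinFun_of_gt hi] at this
    simpa using this

/-- Entries before the maximum of a `231`-avoiding permutation lie below those after it. -/
lemma Avoids.lt_of_lt_of_lt {n : ℕ} {σ : Equiv.Perm (Fin (n + 1))} (hσ : Avoids σ)
    {k i j : Fin (n + 1)} (hk : σ k = Fin.last n) (hi : i < k) (hj : k < j) : σ i < σ j := by
  by_contra hlt
  have hne : σ i ≠ σ j := fun h => (hi.trans hj).ne (σ.injective h)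
  have hnk : σ i ≠ σ k := fun h => hi.ne (σ.injective h)
  refine hσ ⟨i, k, j, hi, hj, lt_of_le_of_ne (not_lt.1 hlt) hne.symm, ?_⟩
  rw [hk] at hnk ⊢
  exact Fin.lt_last_iff_ne_last.2 hnk

lemma Avoids.apply_lt {n : ℕ} {σ : Equiv.Perm (Fin (n + 1))} (hσ : Avoids σ)
    {k i : Fin (n + 1)} (hk : σ k = Fin.last n) (hi : i < k) : σ i < k := by
  have hsub : (Finset.Iic (σ i)).image σ.symm ⊆ Finset.Iio k := by
    intro j hj
    simp only [Finset.mem_image, Finset.mem_Iic] at hj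
    obtain ⟨v, hv, rfl⟩ := hj
    rw [Finset.mem_Iio]
    by_contra hlt
    rcases (not_lt.1 hlt).eq_or_lt with h | h
    · have : v = Fin.last n := by rw [← hk, h, Equiv.apply_symm_apply]
      rw [this, ← hk] at hv
      have h1 : σ i = σ k := le_antisymm (hk ▸ Fin.le_last _) hv
      exact hi.ne (σ.injective h1)
    · have := hσ.lt_of_lt_of_lt hk hi h
      rw [Equiv.apply_symm_apply] at this
      exact absurd hv (not_le.2 this)
  have := Finset.card_le_card hsub
  rw [Finset.card_image_of_injective _ σ.symm.injective, Fin.card_Iic, Fin.card_Iio] at this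
  exact this

lemma Avoids.le_apply {n : ℕ} {σ : Equiv.Perm (Fin (n + 1))} (hσ : Avoids σ)
    {k j : Fin (n + 1)} (hk : σ k = Fin.last n) (hj : k < j) : k ≤ σ j := by
  have hsub : (Finset.Iio k).image σ ⊆ Finset.Iio (σ j) := by
    intro v hv
    simp only [Finset.mem_image, Finset.mem_Iio] at hv ⊢
    obtain ⟨i, hi, rfl⟩ := hv
    exact hσ.lt_of_lt_of_lt hk hi hj
  have := Finset.card_le_card hsub
  rwa [Finset.card_image_of_injective _ σ.injective, Fin.card_Iio, Fin.card_Iio] at this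

lemma exists_join_eq {n : ℕ} {σ : Equiv.Perm (Fin (n + 1))} (hσ : Avoids σ) {k : Fin (n + 1)}
    (hk : σ k = Fin.last n) : ∃ (τ : Equiv.Perm (Fin k)) (π : Equiv.Perm (Fin (n - k))),
      Avoids τ ∧ Avoids π ∧ join k τ π = σ := by
  have hkn := k.2
  have hlow (i : Fin k) : (σ ⟨i, by omega⟩ : ℕ) < k :=
    hσ.apply_lt (i := ⟨i, by omega⟩) hk i.2
  have hpos (i : Fin (n - k)) : k.1 < k + 1 + i := by omega
  have hhigh (i : Fin (n - k)) : k.1 ≤ σ ⟨k + 1 + i, by omega⟩ :=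
    hσ.le_apply (j := ⟨k + 1 + i, by omega⟩) hk (hpos i)
  have hhigh' (i : Fin (n - k)) : (σ ⟨k + 1 + i, by omega⟩ : ℕ) < n := by
    have h1 : σ ⟨k + 1 + i, by omega⟩ ≠ σ k := fun h => by
      have := congrArg Fin.val (σ.injective h)
      simp only at this
      omega
    rw [hk] at h1
    exact Fin.lt_last_iff_ne_last.2 h1
  let f : Fin k → Fin k := fun i => ⟨σ ⟨i, by omega⟩, hlow i⟩
  let g : Fin (n - k) → Fin (n - k) := fun i =>
    ⟨σ ⟨k + 1 + i, by omega⟩ - k, by have := hhigh i; have := hhigh' i; omega⟩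
  have hf : Function.Injective f := by
    intro i j h
    have h0 : σ ⟨i, by omega⟩ = σ ⟨j, by omega⟩ := Fin.ext (Fin.mk.inj h)
    exact Fin.ext (Fin.mk.inj (σ.injective h0))
  have hg : Function.Injective g := by
    intro i j h
    have h0 := congrArg Fin.val h
    simp only [g] at h0
    have h1 : σ ⟨k + 1 + i, by omega⟩ = σ ⟨k + 1 + j, by omega⟩ := by
      apply Fin.ext
      have := hhigh i
      have := hhigh j
      omega
    have h2 := congrArg Fin.val (σ.injective h1)
    simp only at h2
    apply Fin.ext
    omega
  refine ⟨Equiv.ofBijective f (Finite.injective_iff_bijective.1 hf),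
    Equiv.ofBijective g (Finite.injective_iff_bijective.1 hg), ?_, ?_, ?_⟩
  · rintro ⟨a, b, c, hab, hbc, hca, hab'⟩
    exact hσ ⟨⟨a, by omega⟩, ⟨b, by omega⟩, ⟨c, by omega⟩, hab, hbc, hca, hab'⟩
  · rintro ⟨a, b, c, hab, hbc, hca, hab'⟩
    simp only [Equiv.ofBijective_apply, g, Fin.lt_def] at hca hab'
    refine hσ ⟨⟨k + 1 + a, by omega⟩, ⟨k + 1 + b, by omega⟩, ⟨k + 1 + c, by omega⟩, ?_, ?_, ?_, ?_⟩
      <;> simp only [Fin.lt_def] at * <;> omega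
  · ext i
    rw [join_apply]
    rcases lt_trichotomy i k with h | h | h
    · rw [joinFun_of_lt h]
      rfl
    · rw [h, joinFun_self, hk]
    · have h' : k.1 < i.1 := h
      rw [joinFun_of_gt h]
      have hi := hhigh ⟨i - (k + 1), by omega⟩
      have e : (⟨k + 1 + (i.1 - (k.1 + 1)), by omega⟩ : Fin (n + 1)) = i := by
        apply Fin.ext
        simp only
        omega
      simp only [Equiv.ofBijective_apply, g, e] at hi ⊢
      omega

lemma card_avoids_apply_eq_last {n : ℕ} (k : Fin (n + 1)) :
    Nat.card {σ : Equiv.Perm (Fin (n + 1)) // Avoids σ ∧ σ k = Fin.last n} =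
      avCard k * avCard (n - k) := by
  rw [avCard, avCard, ← Nat.card_prod]
  symm
  refine Nat.card_eq_of_bijective
    (fun p => ⟨join k p.1.1 p.2.1, join_avoids p.1.2 p.2.2, joinFun_self⟩) ⟨?_, ?_⟩
  · rintro ⟨⟨τ, hτ⟩, π, hπ⟩ ⟨⟨τ', hτ'⟩, π', hπ'⟩ h
    obtain ⟨rfl, rfl⟩ := join_injective k (congrArg Subtype.val h)
    rfl
  · rintro ⟨σ, hσ, hk⟩
    obtain ⟨τ, π, hτ, hπ, rfl⟩ := exists_join_eq hσ hk
    exact ⟨⟨⟨τ, hτ⟩, π, hπ⟩, rfl⟩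

lemma avCard_succ (n : ℕ) : avCard (n + 1) = ∑ k : Fin (n + 1), avCard k * avCard (n - k) := by
  simp_rw [← card_avoids_apply_eq_last]
  rw [← Nat.card_sigma]
  refine Nat.card_congr ⟨fun σ => ⟨σ.1.symm (Fin.last n), σ.1, σ.2, by simp⟩,
    fun p => ⟨p.2.1, p.2.2.1⟩, fun _ => rfl, ?_⟩
  rintro ⟨k, σ, hσ, hk⟩
  obtain rfl : k = σ.symm (Fin.last n) := by rw [← hk, Equiv.symm_apply_apply]
  rfl

lemma avCard_zero : avCard 0 = 1 := by
  rw [avCard, Nat.card_eq_one_iff_unique]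
  exact ⟨inferInstance, ⟨1, fun ⟨i, _⟩ => i.elim0⟩⟩

lemma avCard_eq_catalan (n : ℕ) : avCard n = catalan n := by
  induction n using Nat.strong_induction_on with
  | _ n ih =>
    cases n with
    | zero => rw [avCard_zero, catalan_zero]
    | succ n =>
      rw [avCard_succ, catalan_succ]
      refine Finset.sum_congr rfl fun k _ => ?_
      rw [ih k k.2, ih (n - k) (by omega)]

lemma card_avoids_zero_eq_last (n : ℕ) :
    Nat.card {σ : Equiv.Perm (Fin (n + 1)) // Avoids σ ∧ σ 0 = Fin.last n} = catalan n := by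
  rw [card_avoids_apply_eq_last, ← avCard_eq_catalan]
  simp [avCard_zero]

/-! ### Prepending a minimum -/

/-- The permutation `1 ⊕ τ`. -/
def prepend {n : ℕ} (τ : Equiv.Perm (Fin n)) : Equiv.Perm (Fin (n + 1)) :=
  Equiv.Perm.decomposeFin.symm (0, τ)

section Prepend

variable {n : ℕ} (τ : Equiv.Perm (Fin n))

lemma prepend_zero : prepend τ 0 = 0 := by simp [prepend]

lemma prepend_succ (i : Fin n) : prepend τ i.succ = (τ i).succ := by simp [prepend]

lemma avoids_prepend : Avoids (prepend τ) ↔ Avoids τ := by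
  refine not_congr ⟨?_, ?_⟩
  · rintro ⟨i, j, k, hij, hjk, hki, hij'⟩
    have hk : k ≠ 0 := Fin.ne_zero_of_lt hjk
    have hj : j ≠ 0 := Fin.ne_zero_of_lt hij
    have hi : i ≠ 0 := by
      rintro rfl
      rw [prepend_zero] at hki
      exact absurd hki (Fin.not_lt_zero _)
    obtain ⟨i, rfl⟩ := Fin.exists_succ_eq.2 hi
    obtain ⟨j, rfl⟩ := Fin.exists_succ_eq.2 hj
    obtain ⟨k, rfl⟩ := Fin.exists_succ_eq.2 hk
    simp only [prepend_succ, Fin.succ_lt_succ_iff] at *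
    exact ⟨i, j, k, hij, hjk, hki, hij'⟩
  · rintro ⟨i, j, k, hij, hjk, hki, hij'⟩
    refine ⟨i.succ, j.succ, k.succ, ?_⟩
    simp only [prepend_succ, Fin.succ_lt_succ_iff]
    exact ⟨hij, hjk, hki, hij'⟩

lemma prepend_injective : Function.Injective (prepend (n := n)) := fun _ _ h =>
  (Prod.mk.inj (Equiv.Perm.decomposeFin.symm.injective h)).2

lemma exists_prepend_eq {σ : Equiv.Perm (Fin (n + 1))} (h : σ 0 = 0) :
    ∃ τ, prepend τ = σ := by
  obtain ⟨⟨p, τ⟩, rfl⟩ := Equiv.Perm.decomposeFin.symm.surjective σ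
  rw [Equiv.Perm.decomposeFin_symm_apply_zero] at h
  exact ⟨τ, by rw [prepend, h]⟩

end Prepend

/-! ### Sentences -/

/-- The formula `x <_P y`. -/
def posLt {n : ℕ} (x y : L.Term (Empty ⊕ Fin n)) : L.BoundedFormula Empty n :=
  .rel (TwoRel.lp : L.Relations 2) ![x, y]

/-- The formula `x <_V y`. -/
def valLt {n : ℕ} (x y : L.Term (Empty ⊕ Fin n)) : L.BoundedFormula Empty n :=
  .rel (TwoRel.lv : L.Relations 2) ![x, y]

/-- The last free variable is not the first position. -/
def notFirst (n : ℕ) : L.BoundedFormula Empty (n + 1) :=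
  (posLt (.var (.inr (Fin.last (n + 1)))) (.var (.inr (Fin.last n).castSucc))).ex

/-- Relativization of a formula to the positions other than the first one. -/
def relativize : ∀ {n : ℕ}, L.BoundedFormula Empty n → L.BoundedFormula Empty n
  | _, .falsum => .falsum
  | _, .equal t u => .equal t u
  | _, .rel r ts => .rel r ts
  | _, .imp f g => (relativize f).imp (relativize g)
  | n, .all f => ((notFirst n).imp (relativize f)).all

/-- The first entry is the minimum. -/
def firstMin : L.Sentence :=
  ((notFirst 0) ⊔ (valLt (.var (.inr 1)) (.var (.inr 0))).not.all).all

/-- The first entry is the maximum. -/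
def firstMax : L.Sentence :=
  ((notFirst 0) ⊔ (valLt (.var (.inr 0)) (.var (.inr 1))).not.all).all

section Realize

variable {n : ℕ} (σ : Equiv.Perm (Fin n))

lemma realize_posLt {m : ℕ} (x y : L.Term (Empty ⊕ Fin m)) (v : Empty → Fin n)
    (xs : Fin m → Fin n) : letI := pStruct σ
    (posLt x y).Realize v xs ↔ x.realize (Sum.elim v xs) < y.realize (Sum.elim v xs) :=
  Iff.rfl

lemma realize_valLt {m : ℕ} (x y : L.Term (Empty ⊕ Fin m)) (v : Empty → Fin n)
    (xs : Fin m → Fin n) : letI := pStruct σ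
    (valLt x y).Realize v xs ↔ σ (x.realize (Sum.elim v xs)) < σ (y.realize (Sum.elim v xs)) :=
  Iff.rfl

lemma realize_notFirst (σ : Equiv.Perm (Fin (n + 1))) {m : ℕ} (v : Empty → Fin (n + 1))
    (xs : Fin m → Fin (n + 1)) (y : Fin (n + 1)) : letI := pStruct σ
    (notFirst m).Realize v (Fin.snoc xs y : Fin (m + 1) → Fin (n + 1)) ↔ y ≠ 0 := by
  let := pStruct σ
  rw [notFirst, Language.BoundedFormula.realize_ex]
  simp only [realize_posLt, Language.Term.realize_var, Sum.elim_inr, Fin.snoc_last,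
    Fin.snoc_castSucc]
  exact ⟨fun ⟨_, h⟩ => Fin.ne_zero_of_lt h, fun h => ⟨0, Fin.pos_of_ne_zero h⟩⟩

lemma sat_firstMin (σ : Equiv.Perm (Fin (n + 1))) : Sat σ firstMin ↔ σ 0 = 0 := by
  let := pStruct σ
  rw [Sat, firstMin, Language.Sentence.Realize, Language.Formula.Realize,
    Language.BoundedFormula.realize_all]
  simp only [Language.BoundedFormula.realize_all, Language.BoundedFormula.realize_sup,
    realize_notFirst, Language.BoundedFormula.realize_not, realize_valLt]
  change (∀ x, x ≠ 0 ∨ ∀ y, ¬ σ y < σ x) ↔ _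
  constructor
  · intro h
    have := (h 0).resolve_left (not_not.2 rfl) (σ.symm 0)
    rwa [Equiv.apply_symm_apply, Fin.pos_iff_ne_zero, not_not] at this
  · intro h x
    rw [or_iff_not_imp_left, not_not]
    rintro rfl y
    rw [h]
    exact Fin.not_lt_zero _

lemma sat_firstMax (σ : Equiv.Perm (Fin (n + 1))) : Sat σ firstMax ↔ σ 0 = Fin.last n := by
  let := pStruct σ
  rw [Sat, firstMax, Language.Sentence.Realize, Language.Formula.Realize,
    Language.BoundedFormula.realize_all]
  simp only [Language.BoundedFormula.realize_all, Language.BoundedFormula.realize_sup,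
    realize_notFirst, Language.BoundedFormula.realize_not, realize_valLt]
  change (∀ x, x ≠ 0 ∨ ∀ y, ¬ σ x < σ y) ↔ _
  constructor
  · intro h
    have := (h 0).resolve_left (not_not.2 rfl) (σ.symm (Fin.last n))
    rwa [Equiv.apply_symm_apply, Fin.lt_last_iff_ne_last, not_not] at this
  · intro h x
    rw [or_iff_not_imp_left, not_not]
    rintro rfl y
    rw [h]
    exact (Fin.le_last _).not_gt

lemma realize_term_succ (τ : Equiv.Perm (Fin n)) {m : ℕ} (t : L.Term (Empty ⊕ Fin m))
    (v : Empty → Fin n) (v' : Empty → Fin (n + 1)) (xs : Fin m → Fin n) :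
    @Language.Term.realize L _ (pStruct (prepend τ)) _ (Sum.elim v' (Fin.succ ∘ xs)) t =
      (@Language.Term.realize L _ (pStruct τ) _ (Sum.elim v xs) t).succ := by
  cases t with
  | var x => rcases x with x | x
             · exact x.elim
             · rfl
  | func f _ => exact nomatch f

lemma realize_relativize (τ : Equiv.Perm (Fin n)) {m : ℕ} (φ : L.BoundedFormula Empty m)
    (v : Empty → Fin n) (v' : Empty → Fin (n + 1)) (xs : Fin m → Fin n) :
    @Language.BoundedFormula.Realize L _ (pStruct (prepend τ)) _ _ (relativize φ) v'
        (Fin.succ ∘ xs) ↔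
      @Language.BoundedFormula.Realize L _ (pStruct τ) _ _ φ v xs := by
  induction φ with
  | falsum => exact Iff.rfl
  | equal t u =>
    simp only [relativize, Language.BoundedFormula.Realize]
    rw [realize_term_succ τ t v, realize_term_succ τ u v, Fin.succ_inj]
  | rel r ts =>
    simp only [relativize, Language.BoundedFormula.Realize, realize_term_succ τ _ v]
    cases r with
    | lp => exact Fin.succ_lt_succ_iff
    | lv =>
      change prepend τ _ < prepend τ _ ↔ τ _ < τ _
      rw [prepend_succ, prepend_succ, Fin.succ_lt_succ_iff]
  | imp f g ihf ihg => exact imp_congr (ihf xs) (ihg xs)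
  | all f ih =>
    simp only [relativize, Language.BoundedFormula.realize_all,
      Language.BoundedFormula.realize_imp, realize_notFirst]
    rw [Fin.forall_fin_succ]
    simp only [ne_eq, not_true_eq_false, false_imp_iff, true_and, Fin.succ_ne_zero,
      not_false_eq_true, true_imp_iff]
    refine forall_congr' fun y => ?_
    rw [← ih, Fin.comp_snoc]

lemma sat_relativize (τ : Equiv.Perm (Fin n)) (ψ : L.Sentence) :
    Sat (prepend τ) (relativize ψ) ↔ Sat τ ψ := by
  refine Iff.trans (iff_of_eq ?_) (realize_relativize τ ψ _ default _)
  unfold Sat Language.Sentence.Realize Language.Formula.Realize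
  congr 1 <;> exact Subsingleton.elim _ _

lemma sat_inf (φ ψ : L.Sentence) : Sat σ (φ ⊓ ψ) ↔ Sat σ φ ∧ Sat σ ψ :=
  letI := pStruct σ
  Language.BoundedFormula.realize_inf

lemma sat_sup (φ ψ : L.Sentence) : Sat σ (φ ⊔ ψ) ↔ Sat σ φ ∨ Sat σ ψ :=
  letI := pStruct σ
  Language.BoundedFormula.realize_sup

lemma sat_not (φ : L.Sentence) : Sat σ φ.not ↔ ¬ Sat σ φ :=
  letI := pStruct σ
  Language.BoundedFormula.realize_not

lemma not_sat_bot : ¬ Sat σ ⊥ := id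

end Realize

/-! ### Counting permutations satisfying a sentence -/

lemma avN_bot (n : ℕ) : avN n ⊥ = 0 := by
  rw [avN, Nat.card_eq_zero]
  exact .inl ⟨fun σ => not_sat_bot _ σ.2.2⟩

lemma avN_add_avN_not (n : ℕ) (ψ : L.Sentence) : avN n ψ + avN n ψ.not = catalan n := by
  classical
  rw [← avCard_eq_catalan, avN, avN, avCard]
  simp only [sat_not, Nat.card_eq_fintype_card, Fintype.card_subtype]
  rw [← Finset.card_filter_add_card_filter_not (s := Finset.univ.filter Avoids)
    (fun σ => Sat σ ψ), Finset.filter_filter, Finset.filter_filter]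

lemma avN_firstMin_inf (n : ℕ) (ψ : L.Sentence) :
    avN (n + 1) (firstMin ⊓ relativize ψ) = avN n ψ := by
  symm
  refine Nat.card_eq_of_bijective (fun τ => ⟨prepend τ.1, (avoids_prepend _).2 τ.2.1,
    (sat_inf _ _ _).2 ⟨(sat_firstMin _).2 (prepend_zero _), (sat_relativize _ _).2 τ.2.2⟩⟩) ⟨?_, ?_⟩
  · intro τ τ' h
    exact Subtype.ext (prepend_injective (congrArg Subtype.val h))
  · rintro ⟨σ, hσ, hsat⟩
    rw [sat_inf, sat_firstMin] at hsat
    obtain ⟨τ, rfl⟩ := exists_prepend_eq hsat.1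
    exact ⟨⟨τ, (avoids_prepend _).1 hσ, (sat_relativize _ _).1 hsat.2⟩, rfl⟩

lemma avN_firstMax_sup {n : ℕ} (hn : 0 < n) (ψ : L.Sentence) :
    avN (n + 1) (firstMax ⊔ (firstMin ⊓ relativize ψ)) = catalan n + avN n ψ := by
  classical
  rw [← avN_firstMin_inf n ψ, ← card_avoids_zero_eq_last, avN, avN]
  simp only [Nat.card_eq_fintype_card, Fintype.card_subtype]
  rw [← Finset.card_union_of_disjoint]
  · congr 1
    ext σ
    simp only [Finset.mem_filter, Finset.mem_univ, true_and, Finset.mem_union, sat_sup,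
      sat_firstMax, and_or_left]
  · rw [Finset.disjoint_filter]
    rintro σ - ⟨-, h⟩ ⟨-, h'⟩
    rw [sat_inf, sat_firstMin, h] at h'
    have := congrArg Fin.val h'.1
    simp only [Fin.val_last, Fin.val_zero] at this
    omega

/-! ### Limits -/

lemma catalan_pos (n : ℕ) : 0 < catalan n :=
  Nat.pos_of_ne_zero fun h => by
    have := succ_mul_catalan_eq_centralBinom n
    rw [h, mul_zero] at this
    exact (Nat.centralBinom_ne_zero n) this.symm

lemma tendsto_catalan_div :
    Tendsto (fun n : ℕ => (catalan n : ℝ) / catalan (n + 1)) atTop (𝓝 (1 / 4)) := by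
  have key (n : ℕ) : (catalan n : ℝ) / catalan (n + 1) = 1 / 4 * (1 + 3 / (2 * n + 1)) := by
    have h1 : ((n : ℝ) + 1) * catalan n = n.centralBinom := by
      exact_mod_cast succ_mul_catalan_eq_centralBinom n
    have h2 : ((n : ℝ) + 1 + 1) * catalan (n + 1) = (n + 1).centralBinom := by
      exact_mod_cast succ_mul_catalan_eq_centralBinom (n + 1)
    have h3 : ((n : ℝ) + 1) * (n + 1).centralBinom = 2 * (2 * n + 1) * n.centralBinom := by
      exact_mod_cast Nat.succ_mul_centralBinom_succ n
    have h4 : ((n : ℝ) + 2) * catalan (n + 1) = 2 * (2 * n + 1) * catalan n := by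
      have hn : (n : ℝ) + 1 ≠ 0 := by positivity
      apply mul_left_cancel₀ hn
      rw [← h1, ← h2] at h3
      linear_combination h3
    have h5 : (catalan (n + 1) : ℝ) ≠ 0 := by exact_mod_cast (catalan_pos _).ne'
    field_simp
    linear_combination (-2) * h4
  simp_rw [key]
  have h : Tendsto (fun n : ℕ => (3 : ℝ) / (2 * n + 1)) atTop (𝓝 0) := by
    refine Tendsto.div_atTop tendsto_const_nhds ?_
    exact tendsto_atTop_add_const_right _ _
      (tendsto_natCast_atTop_atTop.const_mul_atTop (by norm_num))
  simpa using (h.const_add 1).const_mul (1 / 4 : ℝ)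

/-- `l` is the limiting probability of some sentence. -/
def IsLimitProb (l : ℝ) : Prop :=
  ∃ ψ : L.Sentence, Tendsto (fun n : ℕ => prob n ψ) atTop (𝓝 l)

lemma isLimitProb_zero : IsLimitProb 0 :=
  ⟨⊥, by simp [prob, avN_bot]⟩

lemma IsLimitProb.one_sub {l : ℝ} (h : IsLimitProb l) : IsLimitProb (1 - l) := by
  obtain ⟨ψ, hψ⟩ := h
  refine ⟨ψ.not, (hψ.const_sub 1).congr fun n => ?_⟩
  have h0 : (catalan n : ℝ) ≠ 0 := by exact_mod_cast (catalan_pos n).ne'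
  have h1 : (avN n ψ : ℝ) + avN n ψ.not = catalan n := by exact_mod_cast avN_add_avN_not n ψ
  rw [prob, prob, ← h1]
  rw [← h1] at h0
  field_simp
  ring

lemma IsLimitProb.div_four {l : ℝ} (h : IsLimitProb l) : IsLimitProb (l / 4) := by
  obtain ⟨ψ, hψ⟩ := h
  refine ⟨firstMin ⊓ relativize ψ, (tendsto_add_atTop_iff_nat 1).1 ?_⟩
  rw [div_eq_mul_one_div]
  refine (hψ.mul tendsto_catalan_div).congr fun n => ?_
  have h0 : (catalan n : ℝ) ≠ 0 := by exact_mod_cast (catalan_pos n).ne'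
  rw [prob, prob, avN_firstMin_inf]
  field_simp

lemma IsLimitProb.one_add_div_four {l : ℝ} (h : IsLimitProb l) : IsLimitProb ((1 + l) / 4) := by
  obtain ⟨ψ, hψ⟩ := h
  refine ⟨firstMax ⊔ (firstMin ⊓ relativize ψ), (tendsto_add_atTop_iff_nat 1).1 ?_⟩
  rw [div_eq_mul_one_div]
  refine ((hψ.const_add 1).mul tendsto_catalan_div).congr' ?_
  filter_upwards [eventually_gt_atTop 0] with n hn
  have h0 : (catalan n : ℝ) ≠ 0 := by exact_mod_cast (catalan_pos n).ne'
  rw [prob, prob, avN_firstMax_sup hn]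
  push_cast
  field_simp

lemma exists_isLimitProb_near (k : ℕ) :
    ∀ x ∈ Set.Icc (0 : ℝ) 1, ∃ l, IsLimitProb l ∧ |x - l| ≤ (1 / 4) ^ k := by
  induction k with
  | zero =>
    rintro x ⟨h0, h1⟩
    exact ⟨0, isLimitProb_zero, by rw [abs_le]; constructor <;> norm_num <;> linarith⟩
  | succ k ih =>
    have half (x : ℝ) (h0 : 0 ≤ x) (h1 : x ≤ 1 / 2) :
        ∃ l, IsLimitProb l ∧ |x - l| ≤ (1 / 4) ^ (k + 1) := by
      rcases le_total x (1 / 4) with h | h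
      · obtain ⟨l, hl, hx⟩ := ih (4 * x) ⟨by linarith, by linarith⟩
        refine ⟨_, hl.div_four, ?_⟩
        rw [abs_le] at hx ⊢
        rw [pow_succ]
        constructor <;> linarith
      · obtain ⟨l, hl, hx⟩ := ih (4 * x - 1) ⟨by linarith, by linarith⟩
        refine ⟨_, hl.one_add_div_four, ?_⟩
        rw [abs_le] at hx ⊢
        rw [pow_succ]
        constructor <;> linarith
    rintro x ⟨h0, h1⟩
    rcases le_total x (1 / 2) with h | h
    · exact half x h0 h
    · obtain ⟨l, hl, hx⟩ := half (1 - x) (by linarith) (by linarith)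
      refine ⟨_, hl.one_sub, ?_⟩
      rw [abs_le] at hx ⊢
      constructor <;> linarith

/-- The set of limiting probabilities of first-order sentences on uniform random
231-avoiding permutations is dense in `[0,1]`. -/
theorem limiting_probabilities_dense :
    Set.Icc (0 : ℝ) 1 ⊆
      closure {l : ℝ | ∃ ψ : L.Sentence, Tendsto (fun n : ℕ => prob n ψ) atTop (𝓝 l)} := by
  intro x hx
  rw [Metric.mem_closure_iff]
  intro ε hε
  obtain ⟨k, hk⟩ := exists_pow_lt_of_lt_one hε (show (1 / 4 : ℝ) < 1 by norm_num)
  obtain ⟨l, hl, hxl⟩ := exists_isLimitProb_near k x hx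
  exact ⟨l, hl, hxl.trans_lt hk⟩

end Av231
end

section
/- Fix k ≥ 2. For every type t in 𝒯_k^★ (the terminal strongly connected component of the dependency graph G_k), the generating series C_t(z) of 231-avoiding permutations of type t is aperiodic. -/
open FirstOrder Filter Asymptotics Topology

/-- `k`-equivalence as a setoid on finite permutations. -/
def kSetoid (k : ℕ) : Setoid Av231.FinPerm :=
  ⟨Av231.kEquiv k,
    ⟨fun _ _ _ => Iff.rfl, fun h ψ hψ => (h ψ hψ).symm,
      fun h h' ψ hψ => (h ψ hψ).trans (h' ψ hψ)⟩⟩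

namespace Av231

/-- Logical types of order `k`: equivalence classes of `≡ₖ`. -/
def QT (k : ℕ) := Quotient (kSetoid k)

/-- The logical type of order `k` of a permutation. -/
def typeOf (k : ℕ) (p : FinPerm) : QT k := Quotient.mk (kSetoid k) p

/-- A type is realized when some `231`-avoiding permutation has this type;
`𝒯ₖ` consists of the realized types. -/
def Realized (k : ℕ) (t : QT k) : Prop := ∃ p : FinPerm, AvoidsF p ∧ typeOf k p = t

/-- The number of `231`-avoiding permutations of size `n` whose logical type of order `k`
is `t`, i.e. the `n`-th coefficient of the generating series `C_t`. -/
noncomputable def cnt (k : ℕ) (t : QT k) (n : ℕ) : ℕ :=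
  Nat.card {σ : Equiv.Perm (Fin n) // Avoids σ ∧ typeOf k ⟨n, σ⟩ = t}

/-- The type of the empty permutation. -/
def emptyType (k : ℕ) : QT k := typeOf k ⟨0, 1⟩

/-- `H_k(t₁,t₂)`: the type of `τ ⊕ (1 ⊖ π)` where `τ, π` are representatives
of `t₁, t₂` respectively. -/
noncomputable def Hfun (k : ℕ) (t₁ t₂ : QT k) : QT k :=
  typeOf k (glue (Quotient.out t₁) (Quotient.out t₂))

/-- The edge relation `u → t` of the dependency graph `G_k`:
`∂F_t/∂C_u ≠ 0`, i.e. some `v ∈ 𝒯ₖ` satisfies `H_k(u,v) = t` or `H_k(v,u) = t`. -/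
def Edge (k : ℕ) (u t : QT k) : Prop :=
  ∃ v : QT k, Realized k v ∧ (Hfun k u v = t ∨ Hfun k v u = t)

/-- The set `𝒯ₖ` of types realized by `231`-avoiding permutations, as a type. -/
def Tk (k : ℕ) := {t : QT k // Realized k t}

/-- The edge relation of `G_k` restricted to `𝒯ₖ`. -/
def EdgeT (k : ℕ) (u t : Tk k) : Prop := Edge k u.1 t.1

/-- `S` is a terminal strongly connected component of the dependency graph `G_k`:
it is nonempty, any vertex of `S` reaches any other, and no edge leaves `S`
(this forces maximality, hence being an SCC). -/
def IsTermSCC (k : ℕ) (S : Set (Tk k)) : Prop :=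
  S.Nonempty ∧ (∀ u ∈ S, ∀ v ∈ S, Relation.ReflTransGen (EdgeT k) u v) ∧
    (∀ u ∈ S, ∀ v : Tk k, EdgeT k u v → v ∈ S)

/-- A sequence of coefficients is periodic when, for some `d ≥ 2` and `r`,
it vanishes outside `dℤ + r`. -/
def SeqPeriodic (a : ℕ → ℝ) : Prop :=
  ∃ d : ℕ, 2 ≤ d ∧ ∃ r : ℕ, ∀ n : ℕ, n % d ≠ r % d → a n = 0

/-- The generating series `C_t` of `231`-avoiding permutations of type `t`,
evaluated at a complex number `z`. -/
noncomputable def Ct (k : ℕ) (t : QT k) (z : ℂ) : ℂ :=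
  ∑' n : ℕ, (cnt k t n : ℂ) * z ^ n

/-- The Catalan generating function. -/
noncomputable def catGF (z : ℂ) : ℂ := ∑' n : ℕ, (catalan n : ℂ) * z ^ n

/-- The entry `M_k(z)_{t,u} = ∂F_t/∂C_u (z; C_v(z), v ∈ 𝒯ₖ)` of the Jacobian matrix of the
type-refined system. -/
noncomputable def Mmat (k : ℕ) (z : ℂ) (t u : QT k) : ℂ :=
  z * ((∑' v : {v : QT k // Realized k v ∧ Hfun k u v = t}, Ct k v.1 z) +
       (∑' v : {v : QT k // Realized k v ∧ Hfun k v u = t}, Ct k v.1 z))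

/-- `lam` is an eigenvalue of the (possibly infinite) matrix `A`, witnessed by a finitely
supported eigenvector. For finite index types this is the usual notion of eigenvalue. -/
def IsEig {α : Type*} (A : α → α → ℂ) (lam : ℂ) : Prop :=
  ∃ v : α →₀ ℂ, v ≠ 0 ∧ ∀ x : α, ∑ y ∈ v.support, A x y * v y = lam * v x

/-! ### Ehrenfeucht–Fraïssé games on permutations -/

/-- The duplicator wins the `k`-round Ehrenfeucht–Fraïssé game on the permutations `p` and `q`
when the pairs of elements already chosen form the set `R`. -/
def EF (p q : FinPerm) : ℕ → Set (Fin p.1 × Fin q.1) → Prop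
  | 0, R => ∀ x ∈ R, ∀ y ∈ R,
      (x.1 < y.1 ↔ x.2 < y.2) ∧ (p.2 x.1 < p.2 y.1 ↔ q.2 x.2 < q.2 y.2)
  | k + 1, R => (∀ a, ∃ b, EF p q k (insert (a, b) R)) ∧ (∀ b, ∃ a, EF p q k (insert (a, b) R))

theorem EF.mono {p q : FinPerm} {k : ℕ} {R R' : Set (Fin p.1 × Fin q.1)} (hR : R ⊆ R')
    (h : EF p q k R') : EF p q k R := by
  induction k generalizing R R' with
  | zero => exact fun x hx y hy => h x (hR hx) y (hR hy)
  | succ k ih =>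
    refine ⟨fun a => ?_, fun b => ?_⟩
    · obtain ⟨b, hb⟩ := h.1 a
      exact ⟨b, ih (Set.insert_subset_insert hR) hb⟩
    · obtain ⟨a, ha⟩ := h.2 b
      exact ⟨a, ih (Set.insert_subset_insert hR) ha⟩

theorem EF.of_succ {p q : FinPerm} {k : ℕ} {R : Set (Fin p.1 × Fin q.1)}
    (h : EF p q (k + 1) R) : EF p q k R := by
  induction k generalizing R with
  | zero =>
    intro x hx
    obtain ⟨b, hb⟩ := h.1 x.1
    exact EF.mono (Set.subset_insert _ _) hb x hx
  | succ k ih =>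
    refine ⟨fun a => ?_, fun b => ?_⟩
    · obtain ⟨b, hb⟩ := h.1 a
      exact ⟨b, ih hb⟩
    · obtain ⟨a, ha⟩ := h.2 b
      exact ⟨a, ih ha⟩

theorem EF.zero {p q : FinPerm} {k : ℕ} {R : Set (Fin p.1 × Fin q.1)}
    (h : EF p q k R) : EF p q 0 R := by
  induction k with
  | zero => exact h
  | succ k ih => exact ih h.of_succ

/-- Winning strategies on the two parts of a decomposition combine as soon as partial
isomorphisms of the parts do. -/
theorem EF.combine {p q g p' q' g' : FinPerm}
    (f : Fin p.1 → Fin g.1) (h : Fin q.1 → Fin g.1)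
    (f' : Fin p'.1 → Fin g'.1) (h' : Fin q'.1 → Fin g'.1)
    (cover : ∀ z, (∃ x, f x = z) ∨ ∃ y, h y = z)
    (cover' : ∀ z, (∃ x, f' x = z) ∨ ∃ y, h' y = z)
    (base : ∀ R T, EF p p' 0 R → EF q q' 0 T →
      EF g g' 0 (Prod.map f f' '' R ∪ Prod.map h h' '' T)) (k : ℕ) :
    ∀ R T, EF p p' k R → EF q q' k T →
      EF g g' k (Prod.map f f' '' R ∪ Prod.map h h' '' T) := by
  induction k with
  | zero => exact base
  | succ k ih =>
    have left : ∀ R T x x', EF p p' k (insert (x, x') R) → EF q q' k T →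
        EF g g' k (insert (f x, f' x') (Prod.map f f' '' R ∪ Prod.map h h' '' T)) := by
      intro R T x x' h1 h2
      have := ih _ _ h1 h2
      rwa [Set.image_insert_eq, Set.insert_union] at this
    have right : ∀ R T y y', EF p p' k R → EF q q' k (insert (y, y') T) →
        EF g g' k (insert (h y, h' y') (Prod.map f f' '' R ∪ Prod.map h h' '' T)) := by
      intro R T y y' h1 h2
      have := ih _ _ h1 h2
      rwa [Set.image_insert_eq, Set.union_insert] at this
    intro R T hR hT
    refine ⟨fun z => ?_, fun z => ?_⟩
    · rcases cover z with ⟨x, rfl⟩ | ⟨y, rfl⟩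
      · obtain ⟨x', hx⟩ := hR.1 x
        exact ⟨f' x', left _ _ _ _ hx hT.of_succ⟩
      · obtain ⟨y', hy⟩ := hT.1 y
        exact ⟨h' y', right _ _ _ _ hR.of_succ hy⟩
    · rcases cover' z with ⟨x, rfl⟩ | ⟨y, rfl⟩
      · obtain ⟨x', hx⟩ := hR.2 x
        exact ⟨f x', left _ _ _ _ hx hT.of_succ⟩
      · obtain ⟨y', hy⟩ := hT.2 y
        exact ⟨h y', right _ _ _ _ hR.of_succ hy⟩

/-! ### Direct and skew sums -/

theorem castAdd_or_natAdd {a b : ℕ} (z : Fin (a + b)) :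
    (∃ x : Fin a, Fin.castAdd b x = z) ∨ ∃ y : Fin b, Fin.natAdd a y = z := by
  induction z using Fin.addCases with
  | left x => exact Or.inl ⟨x, rfl⟩
  | right y => exact Or.inr ⟨y, rfl⟩

section Sums

variable {a b : ℕ} (σ : Equiv.Perm (Fin a)) (τ : Equiv.Perm (Fin b))

@[simp] theorem dsum_castAdd (x : Fin a) :
    dsum σ τ (Fin.castAdd b x) = Fin.castAdd b (σ x) := by
  simp [dsum, Equiv.permCongr_apply]

@[simp] theorem dsum_natAdd (y : Fin b) :
    dsum σ τ (Fin.natAdd a y) = Fin.natAdd a (τ y) := by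
  simp [dsum, Equiv.permCongr_apply]

@[simp] theorem val_ssum_castAdd (x : Fin a) :
    (ssum σ τ (Fin.castAdd b x) : ℕ) = b + σ x := by
  simp [ssum, Nat.add_comm]

@[simp] theorem val_ssum_natAdd (y : Fin b) :
    (ssum σ τ (Fin.natAdd a y) : ℕ) = τ y := by
  simp [ssum]

theorem dsum_one_one (a b : ℕ) :
    dsum (1 : Equiv.Perm (Fin a)) (1 : Equiv.Perm (Fin b)) = 1 := by
  ext z
  induction z using Fin.addCases <;> simp

variable {σ τ}

theorem Avoids.dsum (hσ : Avoids σ) (hτ : Avoids τ) : Avoids (dsum σ τ) := by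
  rintro ⟨i, j, k, hij, hjk, hki, hij'⟩
  rcases castAdd_or_natAdd i with ⟨i, rfl⟩ | ⟨i, rfl⟩ <;>
  rcases castAdd_or_natAdd j with ⟨j, rfl⟩ | ⟨j, rfl⟩ <;>
  rcases castAdd_or_natAdd k with ⟨k, rfl⟩ | ⟨k, rfl⟩ <;>
  simp only [Fin.lt_def, dsum_castAdd, dsum_natAdd, Fin.val_castAdd, Fin.val_natAdd]
    at hij hjk hki hij' <;>
  first
  | omega
  | exact hσ ⟨i, j, k, hij, hjk, hki, hij'⟩
  | exact hτ ⟨i, j, k, by rw [Fin.lt_def]; omega, by rw [Fin.lt_def]; omega,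
      by rw [Fin.lt_def]; omega, by rw [Fin.lt_def]; omega⟩

theorem Avoids.one_ssum (hτ : Avoids τ) : Avoids (ssum (1 : Equiv.Perm (Fin 1)) τ) := by
  rintro ⟨i, j, k, hij, hjk, hki, hij'⟩
  rcases castAdd_or_natAdd i with ⟨i, rfl⟩ | ⟨i, rfl⟩ <;>
  rcases castAdd_or_natAdd j with ⟨j, rfl⟩ | ⟨j, rfl⟩ <;>
  rcases castAdd_or_natAdd k with ⟨k, rfl⟩ | ⟨k, rfl⟩ <;>
  simp only [Fin.lt_def, val_ssum_castAdd, val_ssum_natAdd, Fin.val_castAdd, Fin.val_natAdd]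
    at hij hjk hki hij' <;>
  first
  | omega
  | exact hτ ⟨i, j, k, by rw [Fin.lt_def]; omega, by rw [Fin.lt_def]; omega, hki, hij'⟩

end Sums

theorem AvoidsF.glue {p q : FinPerm} (hp : AvoidsF p) (hq : AvoidsF q) : AvoidsF (glue p q) :=
  Avoids.dsum hp (Avoids.one_ssum hq)

theorem EF.dsum {p q p' q' : FinPerm} {k : ℕ} {R : Set (Fin p.1 × Fin p'.1)}
    {T : Set (Fin q.1 × Fin q'.1)} (hR : EF p p' k R) (hT : EF q q' k T) :
    EF ⟨p.1 + q.1, Av231.dsum p.2 q.2⟩ ⟨p'.1 + q'.1, Av231.dsum p'.2 q'.2⟩ k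
      (Prod.map (Fin.castAdd q.1) (Fin.castAdd q'.1) '' R ∪
        Prod.map (Fin.natAdd p.1) (Fin.natAdd p'.1) '' T) := by
  refine EF.combine (g := ⟨_, _⟩) (g' := ⟨_, _⟩) _ _ _ _ castAdd_or_natAdd castAdd_or_natAdd
    (fun R T hR hT => ?_) k R T hR hT
  rintro _ (⟨x, hx, rfl⟩ | ⟨x, hx, rfl⟩) _ (⟨y, hy, rfl⟩ | ⟨y, hy, rfl⟩)
  · have := hR x hx y hy
    simp only [Prod.map_fst, Prod.map_snd, Fin.lt_def, dsum_castAdd, Fin.val_castAdd] at this ⊢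
    omega
  · simp only [Prod.map_fst, Prod.map_snd, Fin.lt_def, dsum_castAdd, dsum_natAdd,
      Fin.val_castAdd, Fin.val_natAdd]
    omega
  · simp only [Prod.map_fst, Prod.map_snd, Fin.lt_def, dsum_castAdd, dsum_natAdd,
      Fin.val_castAdd, Fin.val_natAdd]
    omega
  · have := hT x hx y hy
    simp only [Prod.map_fst, Prod.map_snd, Fin.lt_def, dsum_natAdd, Fin.val_natAdd] at this ⊢
    omega

theorem EF.ssum {p q p' q' : FinPerm} {k : ℕ} {R : Set (Fin p.1 × Fin p'.1)}
    {T : Set (Fin q.1 × Fin q'.1)} (hR : EF p p' k R) (hT : EF q q' k T) :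
    EF ⟨p.1 + q.1, Av231.ssum p.2 q.2⟩ ⟨p'.1 + q'.1, Av231.ssum p'.2 q'.2⟩ k
      (Prod.map (Fin.castAdd q.1) (Fin.castAdd q'.1) '' R ∪
        Prod.map (Fin.natAdd p.1) (Fin.natAdd p'.1) '' T) := by
  refine EF.combine (g := ⟨_, _⟩) (g' := ⟨_, _⟩) _ _ _ _ castAdd_or_natAdd castAdd_or_natAdd
    (fun R T hR hT => ?_) k R T hR hT
  rintro _ (⟨x, hx, rfl⟩ | ⟨x, hx, rfl⟩) _ (⟨y, hy, rfl⟩ | ⟨y, hy, rfl⟩)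
  · have := hR x hx y hy
    simp only [Prod.map_fst, Prod.map_snd, Fin.lt_def, val_ssum_castAdd, Fin.val_castAdd] at this ⊢
    omega
  · simp only [Prod.map_fst, Prod.map_snd, Fin.lt_def, val_ssum_castAdd, val_ssum_natAdd,
      Fin.val_castAdd, Fin.val_natAdd]
    omega
  · simp only [Prod.map_fst, Prod.map_snd, Fin.lt_def, val_ssum_castAdd, val_ssum_natAdd,
      Fin.val_castAdd, Fin.val_natAdd]
    omega
  · have := hT x hx y hy
    simp only [Prod.map_fst, Prod.map_snd, Fin.lt_def, val_ssum_natAdd, Fin.val_natAdd] at this ⊢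
    omega

theorem EF.refl (p : FinPerm) (k : ℕ) {R : Set (Fin p.1 × Fin p.1)} (hR : ∀ x ∈ R, x.1 = x.2) :
    EF p p k R := by
  induction k generalizing R with
  | zero =>
    intro x hx y hy
    simp [hR x hx, hR y hy]
  | succ k ih =>
    exact ⟨fun a => ⟨a, ih (by simpa using hR)⟩, fun a => ⟨a, ih (by simpa using hR)⟩⟩

theorem EF.glue {p q p' q' : FinPerm} {k : ℕ} (hp : EF p p' k ∅) (hq : EF q q' k ∅) :
    EF (glue p q) (glue p' q') k ∅ :=
  EF.mono (Set.empty_subset _)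
    (EF.dsum hp (EF.ssum (EF.refl ⟨1, 1⟩ k (R := ∅) (by simp)) hq))

/-! ### Increasing permutations -/

/-- Choosing corresponding points in two increasing permutations splits the game into games on
the parts to the left and to the right of these points. -/
theorem EF.increasing_point {k a b a' b' : ℕ}
    (hl : EF ⟨a, 1⟩ ⟨a', 1⟩ k ∅) (hr : EF ⟨b, 1⟩ ⟨b', 1⟩ k ∅) :
    EF ⟨a + (1 + b), 1⟩ ⟨a' + (1 + b'), 1⟩ k
      {(Fin.natAdd a (Fin.castAdd b 0), Fin.natAdd a' (Fin.castAdd b' 0))} := by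
  have h := EF.dsum hl (EF.dsum (EF.refl ⟨1, 1⟩ k (R := {(0, 0)}) (by simp)) hr)
  rw [dsum_one_one, dsum_one_one, dsum_one_one, dsum_one_one] at h
  exact EF.mono (by simp) h

/-- Increasing permutations of sizes at least `2 ^ k - 1` are indistinguishable in `k` rounds. -/
theorem EF.increasing (k m n : ℕ) (h : m = n ∨ (2 ^ k ≤ m + 1 ∧ 2 ^ k ≤ n + 1)) :
    EF ⟨m, 1⟩ ⟨n, 1⟩ k ∅ := by
  induction k generalizing m n with
  | zero => simp [EF]
  | succ k ih =>
    have split : ∀ m n a : ℕ, (m = n ∨ (2 ^ (k + 1) ≤ m + 1 ∧ 2 ^ (k + 1) ≤ n + 1)) → a < m →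
        ∃ b a' b', m = a + (1 + b) ∧ n = a' + (1 + b') ∧
          (a = a' ∨ (2 ^ k ≤ a + 1 ∧ 2 ^ k ≤ a' + 1)) ∧
          (b = b' ∨ (2 ^ k ≤ b + 1 ∧ 2 ^ k ≤ b' + 1)) := by
      intro m n a h ha
      have hk : 0 < 2 ^ k := by positivity
      rw [pow_succ] at h
      generalize 2 ^ k = c at *
      obtain ⟨b, rfl⟩ : ∃ b, m = a + (1 + b) := ⟨m - a - 1, by omega⟩
      rcases h with rfl | h
      · exact ⟨b, a, b, by simp⟩
      · by_cases h1 : a + 1 < c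
        · exact ⟨b, a, n - a - 1, by omega, by omega, by omega, by omega⟩
        · by_cases h2 : b + 1 < c
          · exact ⟨b, n - b - 1, b, by omega, by omega, by omega, by omega⟩
          · exact ⟨b, c - 1, n - c, by omega, by omega, by omega, by omega⟩
    refine ⟨fun x => ?_, fun x => ?_⟩
    · obtain ⟨b, a', b', h1, h2, hl, hr⟩ := split m n x h x.2
      obtain ⟨x, hx⟩ := x
      dsimp only at *
      subst h1 h2
      refine ⟨Fin.natAdd a' (Fin.castAdd b' 0), ?_⟩
      rw [insert_empty_eq]
      exact EF.increasing_point (ih _ _ hl) (ih _ _ hr)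
    · obtain ⟨b, a', b', h1, h2, hl, hr⟩ := split n m x (by omega) x.2
      obtain ⟨x, hx⟩ := x
      dsimp only at *
      subst h1 h2
      refine ⟨Fin.natAdd a' (Fin.castAdd b' 0), ?_⟩
      rw [insert_empty_eq]
      exact EF.increasing_point (ih a' x (by omega)) (ih b' b (by omega))

theorem avoids_one (n : ℕ) : Avoids (1 : Equiv.Perm (Fin n)) := by
  rintro ⟨i, j, k, hij, hjk, hki, -⟩
  exact absurd (hij.trans hjk) (not_lt.mpr hki.le)

/-! ### Games and first-order sentences -/

/-- Satisfaction of a formula in a permutation, with a valuation of its free variables. -/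
def SatWith (p : FinPerm) {n : ℕ} (φ : L.BoundedFormula Empty n) (x : Fin n → Fin p.1) : Prop :=
  @Language.BoundedFormula.Realize L (Fin p.1) (pStruct p.2) Empty n φ default x

/-- The value of a term in a permutation, with a valuation of its free variables. -/
def termVal (p : FinPerm) {n : ℕ} (s : L.Term (Empty ⊕ Fin n)) (x : Fin n → Fin p.1) : Fin p.1 :=
  @Language.Term.realize L (Fin p.1) (pStruct p.2) _ (Sum.elim default x) s

theorem satWith_lp {p : FinPerm} {n : ℕ} {ts : Fin 2 → L.Term (Empty ⊕ Fin n)}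
    {x : Fin n → Fin p.1} :
    SatWith p (.rel (l := 2) TwoRel.lp ts) x ↔ termVal p (ts 0) x < termVal p (ts 1) x :=
  Iff.rfl

theorem satWith_lv {p : FinPerm} {n : ℕ} {ts : Fin 2 → L.Term (Empty ⊕ Fin n)}
    {x : Fin n → Fin p.1} :
    SatWith p (.rel (l := 2) TwoRel.lv ts) x ↔
      p.2 (termVal p (ts 0) x) < p.2 (termVal p (ts 1) x) :=
  Iff.rfl

theorem satWith_all {p : FinPerm} {n : ℕ} {φ : L.BoundedFormula Empty (n + 1)}
    {x : Fin n → Fin p.1} :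
    SatWith p φ.all x ↔ ∀ a, SatWith p φ (Fin.snoc x a) :=
  Iff.rfl

theorem satWith_imp {p : FinPerm} {n : ℕ} {φ ψ : L.BoundedFormula Empty n}
    {x : Fin n → Fin p.1} :
    SatWith p (φ.imp ψ) x ↔ (SatWith p φ x → SatWith p ψ x) :=
  Iff.rfl

theorem satWith_not {p : FinPerm} {n : ℕ} {φ : L.BoundedFormula Empty n}
    {x : Fin n → Fin p.1} :
    SatWith p φ.not x ↔ ¬ SatWith p φ x :=
  Iff.rfl

theorem qd_not {n : ℕ} (φ : L.BoundedFormula Empty n) : qd φ.not = qd φ := by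
  exact max_eq_left (Nat.zero_le _)

/-- Two permutations with valuations satisfy the same formulas of quantifier depth at most `k`. -/
def Agree (p q : FinPerm) (k : ℕ) {n : ℕ} (x : Fin n → Fin p.1) (y : Fin n → Fin q.1) : Prop :=
  ∀ φ : L.BoundedFormula Empty n, qd φ ≤ k → (SatWith p φ x ↔ SatWith q φ y)

theorem Agree.symm {p q : FinPerm} {k n : ℕ} {x : Fin n → Fin p.1} {y : Fin n → Fin q.1}
    (h : Agree p q k x y) : Agree q p k y x :=
  fun φ hφ => (h φ hφ).symm

theorem range_snoc_pair {α β : Type*} {n : ℕ} (x : Fin n → α) (y : Fin n → β) (a : α) (b : β) :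
    (Set.range fun i => ((Fin.snoc x a : Fin (n + 1) → α) i, (Fin.snoc y b : Fin (n + 1) → β) i)) =
      insert (a, b) (Set.range fun i => (x i, y i)) := by
  ext z
  simp only [Set.mem_range, Set.mem_insert_iff]
  constructor
  · rintro ⟨i, rfl⟩
    induction i using Fin.lastCases with
    | last => simp
    | cast i => exact Or.inr ⟨i, by simp⟩
  · rintro (rfl | ⟨i, rfl⟩)
    · exact ⟨Fin.last n, by simp⟩
    · exact ⟨i.castSucc, by simp⟩

theorem term_eq_var {n : ℕ} (s : L.Term (Empty ⊕ Fin n)) : ∃ i, s = .var (Sum.inr i) := by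
  match s with
  | .var (Sum.inr i) => exact ⟨i, rfl⟩
  | .func f _ => exact nomatch f

theorem EF.agree {p q : FinPerm} {k n : ℕ} {x : Fin n → Fin p.1} {y : Fin n → Fin q.1}
    (h : EF p q k (Set.range fun i => (x i, y i))) : Agree p q k x y := by
  intro φ hφ
  induction φ generalizing k with
  | falsum => rfl
  | equal s t =>
    obtain ⟨i, rfl⟩ := term_eq_var s
    obtain ⟨j, rfl⟩ := term_eq_var t
    have h1 := (h.zero _ ⟨i, rfl⟩ _ ⟨j, rfl⟩).1
    have h2 := (h.zero _ ⟨j, rfl⟩ _ ⟨i, rfl⟩).1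
    change x i = x j ↔ y i = y j
    simp only at h1 h2
    simp only [Fin.lt_def, Fin.ext_iff] at *
    omega
  | rel r ts =>
    cases r with
    | lp =>
      obtain ⟨i, hi⟩ := term_eq_var (ts 0)
      obtain ⟨j, hj⟩ := term_eq_var (ts 1)
      have h1 := (h.zero _ ⟨i, rfl⟩ _ ⟨j, rfl⟩).1
      simp only [satWith_lp, hi, hj]
      exact h1
    | lv =>
      obtain ⟨i, hi⟩ := term_eq_var (ts 0)
      obtain ⟨j, hj⟩ := term_eq_var (ts 1)
      have h1 := (h.zero _ ⟨i, rfl⟩ _ ⟨j, rfl⟩).2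
      simp only [satWith_lv, hi, hj]
      exact h1
  | imp f g ihf ihg =>
    rw [satWith_imp, satWith_imp, ihf h (le_trans (le_max_left _ _) hφ),
      ihg h (le_trans (le_max_right _ _) hφ)]
  | all f ih =>
    obtain ⟨k, rfl⟩ : ∃ l, k = l + 1 := ⟨k - 1, by simp only [qd] at hφ; omega⟩
    have hf : qd f ≤ k := by simpa [qd] using hφ
    rw [satWith_all, satWith_all]
    constructor
    · intro H b
      obtain ⟨a, ha⟩ := h.2 b
      rw [← range_snoc_pair] at ha
      exact (ih ha hf).1 (H a)
    · intro H a
      obtain ⟨b, hb⟩ := h.1 a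
      rw [← range_snoc_pair] at hb
      exact (ih hb hf).2 (H b)

/-- Finitely many formulas of depth at most `k` have a conjunction of depth at most `k`. -/
theorem exists_conj {k n : ℕ} {ι : Type*} (s : Finset ι) (φ : ι → L.BoundedFormula Empty n)
    (hφ : ∀ i, qd (φ i) ≤ k) :
    ∃ ψ : L.BoundedFormula Empty n, qd ψ ≤ k ∧
      ∀ (p : FinPerm) (x : Fin n → Fin p.1), SatWith p ψ x ↔ ∀ i ∈ s, SatWith p (φ i) x := by
  classical
  induction s using Finset.induction_on with
  | empty =>
    refine ⟨Language.BoundedFormula.not .falsum, by rw [qd_not]; exact Nat.zero_le k, fun p x => ?_⟩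
    simp only [satWith_not, Finset.notMem_empty, false_imp_iff, implies_true, iff_true]
    exact id
  | insert i s _ ih =>
    obtain ⟨ψ, hψ, H⟩ := ih
    refine ⟨((φ i).imp ψ.not).not, ?_, fun p x => ?_⟩
    · rw [qd_not]
      exact max_le (hφ i) ((qd_not ψ).le.trans hψ)
    · simp only [satWith_not, satWith_imp, H, Finset.mem_insert, forall_eq_or_imp, Classical.not_imp,
        not_not]

theorem Agree.forth {p q : FinPerm} {k n : ℕ} {x : Fin n → Fin p.1} {y : Fin n → Fin q.1}
    (h : Agree p q (k + 1) x y) (a : Fin p.1) :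
    ∃ b, Agree p q k (Fin.snoc x a : Fin (n + 1) → Fin p.1) (Fin.snoc y b) := by
  by_contra! H
  have sep : ∀ b, ∃ φ : L.BoundedFormula Empty (n + 1), qd φ ≤ k ∧
      SatWith p φ (Fin.snoc x a) ∧ ¬ SatWith q φ (Fin.snoc y b) := by
    intro b
    have hb := H b
    simp only [Agree, not_forall] at hb
    obtain ⟨φ, hφ, hne⟩ := hb
    by_cases hp : SatWith p φ (Fin.snoc x a)
    · exact ⟨φ, hφ, hp, fun hq => hne (iff_of_true hp hq)⟩
    · refine ⟨φ.not, by rwa [qd_not], hp, fun hq => hne (iff_of_false hp hq)⟩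
  choose φ hφ hp hq using sep
  obtain ⟨ψ, hψ, hsat⟩ := exists_conj Finset.univ φ hφ
  have key := h ψ.not.all (by simpa [qd, qd_not] using hψ)
  simp only [satWith_all, satWith_not, hsat] at key
  exact key.2 (fun b hb => hq b (hb b (Finset.mem_univ b))) a (fun b _ => hp b)

theorem Agree.ef {p q : FinPerm} {k n : ℕ} {x : Fin n → Fin p.1} {y : Fin n → Fin q.1}
    (h : Agree p q k x y) : EF p q k (Set.range fun i => (x i, y i)) := by
  induction k generalizing n with
  | zero =>
    rintro _ ⟨i, rfl⟩ _ ⟨j, rfl⟩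
    exact ⟨h (.rel (l := 2) TwoRel.lp ![.var (Sum.inr i), .var (Sum.inr j)]) le_rfl,
      h (.rel (l := 2) TwoRel.lv ![.var (Sum.inr i), .var (Sum.inr j)]) le_rfl⟩
  | succ k ih =>
    refine ⟨fun a => ?_, fun b => ?_⟩
    · obtain ⟨b, hb⟩ := h.forth a
      exact ⟨b, range_snoc_pair x y a b ▸ ih hb⟩
    · obtain ⟨a, ha⟩ := h.symm.forth b
      exact ⟨a, range_snoc_pair x y a b ▸ ih ha.symm⟩

theorem kEquiv_iff_EF {k : ℕ} {p q : FinPerm} : kEquiv k p q ↔ EF p q k ∅ := by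
  have hrange : (Set.range fun i : Fin 0 =>
      ((default : Fin 0 → Fin p.1) i, (default : Fin 0 → Fin q.1) i)) = ∅ :=
    Set.range_eq_empty _
  exact ⟨fun h => hrange ▸ Agree.ef h, fun h => EF.agree (hrange.symm ▸ h)⟩

/-! ### Types and the dependency graph -/

theorem typeOf_eq_iff {k : ℕ} {p q : FinPerm} : typeOf k p = typeOf k q ↔ EF p q k ∅ :=
  Quotient.eq (r := kSetoid k) |>.trans kEquiv_iff_EF

theorem Hfun_typeOf (k : ℕ) (p q : FinPerm) :
    Hfun k (typeOf k p) (typeOf k q) = typeOf k (glue p q) :=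
  typeOf_eq_iff.2 (EF.glue (kEquiv_iff_EF.1 (Quotient.mk_out (s := kSetoid k) p))
    (kEquiv_iff_EF.1 (Quotient.mk_out (s := kSetoid k) q)))

/-- The type `t` is realized by a `231`-avoiding permutation of size `n`. -/
def RealizedAt (k : ℕ) (t : QT k) (n : ℕ) : Prop :=
  ∃ σ : Equiv.Perm (Fin n), Avoids σ ∧ typeOf k ⟨n, σ⟩ = t

theorem RealizedAt.cnt_ne_zero {k n : ℕ} {t : QT k} (h : RealizedAt k t n) : cnt k t n ≠ 0 := by
  obtain ⟨σ, hσ⟩ := h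
  have : Nonempty {σ : Equiv.Perm (Fin n) // Avoids σ ∧ typeOf k ⟨n, σ⟩ = t} := ⟨⟨σ, hσ⟩⟩
  exact Nat.card_pos.ne'

theorem RealizedAt.Hfun {k m n : ℕ} {t u : QT k} (ht : RealizedAt k t m)
    (hu : RealizedAt k u n) : RealizedAt k (Hfun k t u) (m + (1 + n)) := by
  obtain ⟨σ, hσ, rfl⟩ := ht
  obtain ⟨τ, hτ, rfl⟩ := hu
  exact ⟨_, AvoidsF.glue (p := ⟨m, σ⟩) (q := ⟨n, τ⟩) hσ hτ, (Hfun_typeOf k ⟨m, σ⟩ ⟨n, τ⟩).symm⟩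

theorem Realized.exists_realizedAt {k : ℕ} {t : QT k} (h : Realized k t) :
    ∃ n, RealizedAt k t n := by
  obtain ⟨p, hp, rfl⟩ := h
  exact ⟨p.1, p.2, hp, rfl⟩

theorem RealizedAt.realized {k n : ℕ} {t : QT k} (h : RealizedAt k t n) : Realized k t := by
  obtain ⟨σ, hσ, h⟩ := h
  exact ⟨⟨n, σ⟩, hσ, h⟩

/-- Some type is realized in two consecutive sizes. -/
theorem exists_realizedAt_consecutive (k : ℕ) :
    ∃ (t : QT k) (n : ℕ), RealizedAt k t n ∧ RealizedAt k t (n + 1) :=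
  ⟨typeOf k ⟨2 ^ k, 1⟩, 2 ^ k, ⟨1, avoids_one _, rfl⟩,
    ⟨1, avoids_one _, typeOf_eq_iff.2 (EF.increasing k _ _ (by omega))⟩⟩

/-- Being realized in two consecutive sizes propagates along edges of the dependency graph. -/
theorem Edge.realizedAt_consecutive {k : ℕ} {u t : QT k} (h : Edge k u t)
    (hu : ∃ n, RealizedAt k u n ∧ RealizedAt k u (n + 1)) :
    ∃ n, RealizedAt k t n ∧ RealizedAt k t (n + 1) := by
  obtain ⟨v, hv, h⟩ := h
  obtain ⟨m, hm⟩ := hv.exists_realizedAt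
  obtain ⟨n, hn, hn'⟩ := hu
  rcases h with rfl | rfl
  · refine ⟨_, hn.Hfun hm, ?_⟩
    convert hn'.Hfun hm using 1
    omega
  · exact ⟨_, hm.Hfun hn, hm.Hfun hn'⟩

/-- For every type `t` in the terminal strongly connected component `𝒯ₖ★` of the
dependency graph, the generating series `C_t` is aperiodic. -/
theorem terminal_types_aperiodic (k : ℕ) (hk : 2 ≤ k) (S : Set (Tk k))
    (hS : IsTermSCC k S) (t : Tk k) (ht : t ∈ S) :
    ¬ SeqPeriodic fun n : ℕ => (cnt k t.1 n : ℝ) := by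
  obtain ⟨⟨u, hu⟩, huS⟩ := hS.1
  obtain ⟨v, hv⟩ := exists_realizedAt_consecutive k
  obtain ⟨n, hn, -⟩ := id hv
  obtain ⟨m, hm⟩ := hu.exists_realizedAt
  have hw : Realized k (Hfun k u v) := (hm.Hfun hn).realized
  have hwS : (⟨Hfun k u v, hw⟩ : Tk k) ∈ S :=
    hS.2.2 _ huS _ ⟨v, hn.realized, Or.inl rfl⟩
  have hreach := hS.2.1 _ hwS t ht
  have hcons : ∃ n, RealizedAt k t.1 n ∧ RealizedAt k t.1 (n + 1) := by
    clear ht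
    induction hreach with
    | refl => exact Edge.realizedAt_consecutive ⟨u, hu, Or.inr rfl⟩ hv
    | tail _ hedge ih => exact Edge.realizedAt_consecutive hedge ih
  obtain ⟨N, h0, h1⟩ := hcons
  rintro ⟨d, hd, r, hr⟩
  have e0 : N % d = r % d := by
    by_contra h
    exact h0.cnt_ne_zero (Nat.cast_eq_zero.1 (hr N h))
  have e1 : (N + 1) % d = r % d := by
    by_contra h
    exact h1.cnt_ne_zero (Nat.cast_eq_zero.1 (hr (N + 1) h))
  have hmod : N + 0 ≡ N + 1 [MOD d] := e0.trans e1.symm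
  have h01 : 0 % d = 1 % d := Nat.ModEq.add_left_cancel' N hmod
  rw [Nat.zero_mod, Nat.mod_eq_of_lt hd] at h01
  exact absurd h01 (by norm_num)

end Av231
end
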